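/- Assume case (BS1), and let φ : [0, d)^ℕ → [0, d)^ℕ and r : [0, d)^ℕ → (ℤ_{≥1})^ℕ be the unique maps satisfying b^d α_k(φ(i)) = α_k(i) b^{c·r(i)_k} for all k. Then for every i ∈ [0, d)^ℕ, every k ∈ ℕ, every h ≥ 1, and every integer m with i_0 + (h−1)d < m ≤ i_0 + h·d, the element b^{h·d} α_k(φ^h(i)) = α_k(i) b^{c·∑_{μ=0}^{h−1} r(φ^μ(i))_k} is the unique minimal common extension of α_k(i) and b^m; that is, b^m Λ ∩ α_k(i) Λ = b^{h·d} α_k(φ^h(i)) Λ. -/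

import Mathlib

inductive BSGen : Type
  | a : BSGen
  | b : BSGen

/-- The relations for the Baumslag–Solitar presentation `⟨a, b | a bᶜ = bᵉ a⟩`.
For cases (BS1), (BS2) take `e = d`; for case (BS3) take `e = -d`. -/
def BSRel (c e : ℤ) : Set (FreeGroup BSGen) :=
  {FreeGroup.of BSGen.a * FreeGroup.of BSGen.b ^ c *
    (FreeGroup.of BSGen.b ^ e * FreeGroup.of BSGen.a)⁻¹}

/-- The Baumslag–Solitar group `Γ = ⟨a, b | a bᶜ = bᵉ a⟩`. -/
abbrev BSGroup (c e : ℤ) := PresentedGroup (BSRel c e)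

/-- The generator `a` of `Γ`. -/
def bsa (c e : ℤ) : BSGroup c e := PresentedGroup.of BSGen.a

/-- The generator `b` of `Γ`. -/
def bsb (c e : ℤ) : BSGroup c e := PresentedGroup.of BSGen.b

/-- `Λ`, the submonoid of `Γ` generated by `a` and `b`. -/
def bsΛ (c e : ℤ) : Submonoid (BSGroup c e) :=
  Submonoid.closure {bsa c e, bsb c e}

/-- `[0, d)^ℕ`, the space of sequences with entries in `[0, d)`. -/
abbrev BSSeq (d : ℤ) := ℕ → (Set.Ico (0 : ℤ) d)

/-- For `i ∈ [0,d)^ℕ` and `k ∈ ℕ`, the element `α_k(i) = b^{i₀} a b^{i₁} a ⋯ b^{i_k} a`. -/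
def alphaSeq (c e d : ℤ) (i : BSSeq d) (k : ℕ) : BSGroup c e :=
  (List.ofFn (fun μ : Fin (k + 1) => bsb c e ^ ((i μ.1 : ℤ)) * bsa c e)).prod

theorem bsa_mul_bsb_zpow (c e : ℤ) : bsa c e * bsb c e ^ c = bsb c e ^ e * bsa c e := by
  have h : PresentedGroup.mk (BSRel c e)
      (FreeGroup.of BSGen.a * FreeGroup.of BSGen.b ^ c *
        (FreeGroup.of BSGen.b ^ e * FreeGroup.of BSGen.a)⁻¹) = 1 :=
    PresentedGroup.one_of_mem rfl
  simp only [map_mul, map_inv, map_zpow] at h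
  exact mul_inv_eq_one.mp h

theorem bsb_zpow_mul_bsa (c e q : ℤ) :
    bsb c e ^ (e * q) * bsa c e = bsa c e * bsb c e ^ (c * q) := by
  have h : SemiconjBy (bsa c e) (bsb c e ^ c) (bsb c e ^ e) := bsa_mul_bsb_zpow c e
  simpa [zpow_mul] using (h.zpow_right q).eq.symm

theorem zpowersHom_ofAdd_injective {c : ℤ} (hc : c ≠ 0) :
    Function.Injective (zpowersHom (Multiplicative ℤ) (Multiplicative.ofAdd c)) := by
  rw [injective_iff_map_eq_one]
  intro x hx
  rw [zpowersHom_apply, ← ofAdd_zsmul, ofAdd_eq_one, smul_eq_mul] at hx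
  exact (mul_eq_zero.mp hx).resolve_right hc

/-- The isomorphism `cℤ ≃ eℤ` sending `c` to `e`. -/
noncomputable def zpowersRangeEquiv {c e : ℤ} (hc : c ≠ 0) (he : e ≠ 0) :
    (zpowersHom (Multiplicative ℤ) (Multiplicative.ofAdd c)).range ≃*
      (zpowersHom (Multiplicative ℤ) (Multiplicative.ofAdd e)).range :=
  (MonoidHom.ofInjective (zpowersHom_ofAdd_injective hc)).symm.trans
    (MonoidHom.ofInjective (zpowersHom_ofAdd_injective he))

/-- The canonical map from the Baumslag–Solitar group to the corresponding HNN extension of `ℤ`. -/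
noncomputable def bsToHNN {c e : ℤ} (hc : c ≠ 0) (he : e ≠ 0) :
    BSGroup c e →* HNNExtension (Multiplicative ℤ) _ _ (zpowersRangeEquiv hc he) :=
  PresentedGroup.toGroup
    (f := fun g => BSGen.rec HNNExtension.t
      (HNNExtension.of (Multiplicative.ofAdd (1 : ℤ))) g) <| by
    intro x hx
    rw [BSRel, Set.mem_singleton_iff] at hx
    subst hx
    have h := HNNExtension.t_mul_of (φ := zpowersRangeEquiv hc he)
      (MonoidHom.ofInjective (zpowersHom_ofAdd_injective hc) (Multiplicative.ofAdd 1))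
    simp only [zpowersRangeEquiv, MulEquiv.trans_apply, MulEquiv.symm_apply_apply,
      MonoidHom.ofInjective_apply, zpowersHom_apply, toAdd_ofAdd, zpow_one] at h
    have hof (n : ℤ) : (HNNExtension.of (Multiplicative.ofAdd 1) :
        HNNExtension _ _ _ (zpowersRangeEquiv hc he)) ^ n =
          HNNExtension.of (Multiplicative.ofAdd n) := by
      rw [← map_zpow, ← ofAdd_zsmul, smul_eq_mul, mul_one]
    simp only [map_mul, map_inv, map_zpow, FreeGroup.lift_apply_of, mul_inv_eq_one, hof]
    exact h

theorem bsToHNN_bsa {c e : ℤ} (hc : c ≠ 0) (he : e ≠ 0) :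
    bsToHNN hc he (bsa c e) = HNNExtension.t :=
  PresentedGroup.toGroup.of _

theorem bsToHNN_bsb_zpow {c e : ℤ} (hc : c ≠ 0) (he : e ≠ 0) (n : ℤ) :
    bsToHNN hc he (bsb c e ^ n) = HNNExtension.of (Multiplicative.ofAdd n) := by
  have h : bsToHNN hc he (bsb c e) = HNNExtension.of (Multiplicative.ofAdd 1) :=
    PresentedGroup.toGroup.of _
  rw [map_zpow, h, ← map_zpow, ← ofAdd_zsmul, smul_eq_mul, mul_one]

/-- The submonoid of the Baumslag–Solitar group generated by `a`, `b` and `b⁻¹`. -/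
def bsPos (c e : ℤ) : Submonoid (BSGroup c e) :=
  Submonoid.closure {bsa c e, bsb c e, (bsb c e)⁻¹}

theorem bsa_mem_bsΛ (c e : ℤ) : bsa c e ∈ bsΛ c e :=
  Submonoid.subset_closure (by simp)

theorem bsb_zpow_mem_bsΛ (c e : ℤ) {n : ℤ} (hn : 0 ≤ n) : bsb c e ^ n ∈ bsΛ c e := by
  lift n to ℕ using hn
  rw [zpow_natCast]
  exact pow_mem (Submonoid.subset_closure (by simp)) n

theorem bsΛ_le_bsPos (c e : ℤ) : bsΛ c e ≤ bsPos c e :=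
  Submonoid.closure_mono (by grind)

theorem bsa_mem_bsPos (c e : ℤ) : bsa c e ∈ bsPos c e :=
  Submonoid.subset_closure (by simp)

theorem bsb_zpow_mem_bsPos (c e n : ℤ) : bsb c e ^ n ∈ bsPos c e := by
  obtain ⟨n, rfl | rfl⟩ := n.eq_nat_or_neg
  · rw [zpow_natCast]
    exact pow_mem (Submonoid.subset_closure (by simp)) n
  · rw [zpow_neg, zpow_natCast, ← inv_pow]
    exact pow_mem (Submonoid.subset_closure (by simp)) n

/-- The word `b ^ n a b ^ l₁ a b ^ l₂ ⋯`, as a reduced word in the HNN extension. -/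
def bsReducedWord (A B : Subgroup (Multiplicative ℤ)) (n : ℤ) (l : List ℤ) :
    HNNExtension.NormalWord.ReducedWord (Multiplicative ℤ) A B where
  head := Multiplicative.ofAdd n
  toList := l.map fun k => (1, Multiplicative.ofAdd k)
  chain := by
    rw [List.isChain_map]
    exact List.isChain_iff_getElem.mpr (by simp)

theorem exists_bsReducedWord_prod_eq {c e : ℤ} (hc : c ≠ 0) (he : e ≠ 0) {x : BSGroup c e}
    (hx : x ∈ bsPos c e) :
    ∃ n l, bsToHNN hc he x = (bsReducedWord _ _ n l).prod (zpowersRangeEquiv hc he) := by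
  induction hx using Submonoid.closure_induction_left with
  | one => exact ⟨0, [], by simp [bsReducedWord, HNNExtension.NormalWord.ReducedWord.prod]⟩
  | mul_left y hy z _ ih =>
    obtain ⟨n, l, ih⟩ := ih
    have hb (k : ℤ) : bsToHNN hc he (bsb c e ^ k * z) =
        (bsReducedWord _ _ (k + n) l).prod (zpowersRangeEquiv hc he) := by
      rw [map_mul, ih, bsToHNN_bsb_zpow]
      simp [bsReducedWord, HNNExtension.NormalWord.ReducedWord.prod, mul_assoc]
    rcases hy with rfl | rfl | rfl
    · refine ⟨0, n :: l, ?_⟩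
      rw [map_mul, ih, bsToHNN_bsa]
      simp [bsReducedWord, HNNExtension.NormalWord.ReducedWord.prod, mul_assoc]
    · exact ⟨_, _, by simpa using hb 1⟩
    · exact ⟨_, _, by simpa using hb (-1)⟩

theorem exists_bsReducedWord_cons_prod_eq {c e : ℤ} (hc : c ≠ 0) (he : e ≠ 0) (n : ℤ)
    {x : BSGroup c e} (hx : x ∈ bsPos c e) :
    ∃ k l, bsToHNN hc he (bsb c e ^ n * (bsa c e * x)) =
      (bsReducedWord _ _ n (k :: l)).prod (zpowersRangeEquiv hc he) := by
  obtain ⟨k, l, h⟩ := exists_bsReducedWord_prod_eq hc he hx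
  refine ⟨k, l, ?_⟩
  rw [map_mul, map_mul, h, bsToHNN_bsa, bsToHNN_bsb_zpow]
  simp [bsReducedWord, HNNExtension.NormalWord.ReducedWord.prod, mul_assoc]

theorem dvd_sub_of_zpow_mul_bsa_mul_eq {c e : ℤ} (hc : c ≠ 0) (he : e ≠ 0) {n n' : ℤ}
    {x x' : BSGroup c e} (hx : x ∈ bsPos c e) (hx' : x' ∈ bsPos c e)
    (h : bsb c e ^ n * (bsa c e * x) = bsb c e ^ n' * (bsa c e * x')) : e ∣ n' - n := by
  obtain ⟨k, l, hl⟩ := exists_bsReducedWord_cons_prod_eq hc he n hx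
  obtain ⟨k', l', hl'⟩ := exists_bsReducedWord_cons_prod_eq hc he n' hx'
  have hmem := (HNNExtension.ReducedWord.map_fst_eq_and_of_prod_eq _
    (hl.symm.trans ((congrArg _ h).trans hl'))).2 1 (by simp [bsReducedWord])
  rw [HNNExtension.toSubgroup_neg_one] at hmem
  obtain ⟨q, hq⟩ := hmem
  refine ⟨Multiplicative.toAdd q, ?_⟩
  have := congrArg Multiplicative.toAdd hq
  simp [bsReducedWord] at this
  linarith

theorem zpow_ne_zpow_mul_bsa_mul {c e : ℤ} (hc : c ≠ 0) (he : e ≠ 0) (n n' : ℤ)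
    {x : BSGroup c e} (hx : x ∈ bsPos c e) :
    bsb c e ^ n ≠ bsb c e ^ n' * (bsa c e * x) := by
  intro h
  obtain ⟨k, l, hl⟩ := exists_bsReducedWord_cons_prod_eq hc he n' hx
  have := HNNExtension.ReducedWord.toList_eq_nil_of_mem_of_range _ _
    ⟨Multiplicative.ofAdd n, (bsToHNN_bsb_zpow hc he n).symm.trans ((congrArg _ h).trans hl)⟩
  simp [bsReducedWord] at this

theorem exists_zpow_of_mem_bsΛ {c e : ℤ} {y : BSGroup c e} (hy : y ∈ bsΛ c e) :
    ∃ n : ℤ, 0 ≤ n ∧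
      (y = bsb c e ^ n ∨ ∃ x ∈ bsΛ c e, y = bsb c e ^ n * (bsa c e * x)) := by
  induction hy using Submonoid.closure_induction_left with
  | one => exact ⟨0, le_rfl, .inl (by simp)⟩
  | mul_left y hy z hz ih =>
    rcases hy with rfl | rfl
    · exact ⟨0, le_rfl, .inr ⟨z, hz, by simp⟩⟩
    · obtain ⟨n, hn, rfl | ⟨x, hx, rfl⟩⟩ := ih
      · exact ⟨1 + n, by omega, .inl (by rw [zpow_one_add])⟩
      · exact ⟨1 + n, by omega, .inr ⟨x, hx, by rw [zpow_one_add, mul_assoc]⟩⟩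

/-- If `y ∈ Λ` factors as `b ^ i₀ a b ^ i₁ a ⋯ b ^ i_k a * z` with each `i_j < e` and `z` in the
monoid generated by `a`, `b`, `b⁻¹`, then `z ∈ Λ`. -/
theorem mem_bsΛ_of_prod_mul_mem {c e : ℤ} (hc : 0 < c) (he : 0 < e) (L : List ℤ)
    (hL : ∀ n ∈ L, n < e) {z : BSGroup c e} (hz : z ∈ bsPos c e)
    (h : (L.map fun n => bsb c e ^ n * bsa c e).prod * z ∈ bsΛ c e) : z ∈ bsΛ c e := by
  induction L with
  | nil => simpa using h
  | cons i L ih =>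
    refine ih (fun n hn => hL n (List.mem_cons_of_mem _ hn)) ?_
    have hpos : (L.map fun n => bsb c e ^ n * bsa c e).prod * z ∈ bsPos c e := by
      refine mul_mem (Submonoid.list_prod_mem _ fun x hx => ?_) hz
      obtain ⟨n, -, rfl⟩ := List.mem_map.mp hx
      exact mul_mem (bsb_zpow_mem_bsPos c e n) (bsa_mem_bsPos c e)
    rw [List.map_cons, List.prod_cons, mul_assoc, mul_assoc] at h
    obtain ⟨n, hn, h | ⟨x, hx, h⟩⟩ := exists_zpow_of_mem_bsΛ h
    · exact absurd h.symm (zpow_ne_zpow_mul_bsa_mul hc.ne' he.ne' _ _ hpos)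
    · obtain ⟨q, hq⟩ :=
        dvd_sub_of_zpow_mul_bsa_mul_eq hc.ne' he.ne' hpos (bsΛ_le_bsPos c e hx) h
      have hi := hL i List.mem_cons_self
      have hq0 : 0 ≤ q := by
        by_contra! hneg
        nlinarith
      obtain rfl : n = i + e * q := by linarith
      rw [zpow_add, mul_assoc, mul_right_inj, ← mul_assoc (bsb c e ^ (e * q)),
        bsb_zpow_mul_bsa, mul_assoc, mul_right_inj] at h
      rw [h]
      exact mul_mem (bsb_zpow_mem_bsΛ c e (by positivity)) hx

theorem alphaSeq_eq_list_prod (c e d : ℤ) (i : BSSeq d) (k : ℕ) :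
    alphaSeq c e d i k = ((List.ofFn fun μ : Fin (k + 1) => (i μ : ℤ)).map
      fun n => bsb c e ^ n * bsa c e).prod := by
  rw [List.map_ofFn]
  rfl

theorem exists_alphaSeq_eq (c e d : ℤ) (i : BSSeq d) (k : ℕ) :
    ∃ x ∈ bsΛ c e, alphaSeq c e d i k = bsb c e ^ (i 0 : ℤ) * (bsa c e * x) := by
  rw [alphaSeq, List.ofFn_succ, List.prod_cons, mul_assoc]
  refine ⟨_, Submonoid.list_prod_mem _ fun x hx => ?_, rfl⟩
  obtain ⟨j, rfl⟩ := List.mem_ofFn.mp hx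
  exact mul_mem (bsb_zpow_mem_bsΛ c e (i _).2.1) (bsa_mem_bsΛ c e)

theorem zpow_mul_alphaSeq_iterate {c d : ℤ} {φ : BSSeq d → BSSeq d} {r : BSSeq d → ℕ → ℤ}
    {k : ℕ}
    (heq : ∀ i, bsb c d ^ d * alphaSeq c d d (φ i) k =
      alphaSeq c d d i k * bsb c d ^ (c * r i k))
    (i : BSSeq d) (h : ℕ) :
    bsb c d ^ ((h : ℤ) * d) * alphaSeq c d d (φ^[h] i) k =
      alphaSeq c d d i k * bsb c d ^ (c * ∑ μ ∈ Finset.range h, r (φ^[μ] i) k) := by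
  induction h with
  | zero => simp
  | succ h ih =>
    rw [Finset.sum_range_succ, mul_add, zpow_add, ← mul_assoc, ← ih, mul_assoc, ← heq,
      Function.iterate_succ_apply', Nat.cast_succ, add_one_mul, zpow_add, mul_assoc]

theorem apply_zero_eq_of_zpow_mul_alphaSeq_eq {c d n s : ℤ} (hc : c ≠ 0) (hd : d ≠ 0)
    {i j : BSSeq d} {k : ℕ} (hn : d ∣ n)
    (h : bsb c d ^ n * alphaSeq c d d j k = alphaSeq c d d i k * bsb c d ^ s) :
    (j 0 : ℤ) = i 0 := by
  obtain ⟨x, hx, hix⟩ := exists_alphaSeq_eq c d d i k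
  obtain ⟨y, hy, hjy⟩ := exists_alphaSeq_eq c d d j k
  rw [hix, hjy, ← mul_assoc, ← zpow_add, mul_assoc, mul_assoc] at h
  have hdvd := dvd_sub_of_zpow_mul_bsa_mul_eq hc hd (bsΛ_le_bsPos c d hy)
    (mul_mem (bsΛ_le_bsPos c d hx) (bsb_zpow_mem_bsPos c d s)) h
  have hdvd' : d ∣ (j 0 : ℤ) - i 0 := by
    rw [← dvd_neg]
    convert dvd_add hdvd hn using 1
    ring
  obtain ⟨hi0, hi1⟩ := (i 0).2
  obtain ⟨hj0, hj1⟩ := (j 0).2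
  have := Int.eq_zero_of_abs_lt_dvd hdvd' (by rw [abs_lt]; constructor <;> linarith)
  linarith

/-- Case (BS1).  Let `φ` and `r` be the (unique) maps with `r(i)_k ≥ 1` and
`b^d α_k(φ(i)) = α_k(i) b^{c·r(i)_k}`.  Then for every `i`, `k`, every `h ≥ 1` and every
integer `m` with `i₀ + (h-1)d < m ≤ i₀ + h·d`, the element
`b^{hd} α_k(φ^h(i)) = α_k(i) b^{c·∑_{μ<h} r(φ^μ(i))_k}` is the unique minimal common
extension of `α_k(i)` and `bᵐ`: `bᵐΛ ∩ α_k(i)Λ = b^{hd} α_k(φ^h(i)) Λ`. -/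
theorem statement8 (c d : ℤ) (hd : 1 ≤ d) (hcd : d ≤ c)
    (φ : BSSeq d → BSSeq d) (r : BSSeq d → ℕ → ℤ)
    (hr : ∀ i k, 1 ≤ r i k)
    (heq : ∀ i k, bsb c d ^ d * alphaSeq c d d (φ i) k =
      alphaSeq c d d i k * bsb c d ^ (c * r i k))
    (i : BSSeq d) (k : ℕ) (h : ℕ) (hh : 1 ≤ h) (m : ℤ)
    (hm1 : (i 0 : ℤ) + ((h : ℤ) - 1) * d < m) (hm2 : m ≤ (i 0 : ℤ) + (h : ℤ) * d) :
    bsb c d ^ ((h : ℤ) * d) * alphaSeq c d d (φ^[h] i) k =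
      alphaSeq c d d i k * bsb c d ^ (c * ∑ μ ∈ Finset.range h, r (φ^[μ] i) k) ∧
    ∀ x : BSGroup c d,
      ((∃ γ ∈ bsΛ c d, x = bsb c d ^ m * γ) ∧ (∃ γ ∈ bsΛ c d, x = alphaSeq c d d i k * γ)) ↔
      ∃ γ ∈ bsΛ c d, x = bsb c d ^ ((h : ℤ) * d) * alphaSeq c d d (φ^[h] i) k * γ := by
  have hd0 : 0 < d := by omega
  have hc0 : 0 < c := by omega
  have hmain := zpow_mul_alphaSeq_iterate (fun i => heq i k) i h
  have h0 := apply_zero_eq_of_zpow_mul_alphaSeq_eq hc0.ne' hd0.ne' (dvd_mul_left d _) hmain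
  have hsum : 0 ≤ c * ∑ μ ∈ Finset.range h, r (φ^[μ] i) k :=
    mul_nonneg hc0.le (Finset.sum_nonneg fun μ _ => by linarith [hr (φ^[μ] i) k])
  refine ⟨hmain, fun x => ⟨?_, ?_⟩⟩
  · rintro ⟨⟨γ, hγ, rfl⟩, δ, hδ, hx⟩
    set s := c * ∑ μ ∈ Finset.range h, r (φ^[μ] i) k
    refine ⟨bsb c d ^ (-s) * δ, ?_, ?_⟩
    · have hfac : bsb c d ^ (m - h * d) * γ =
          alphaSeq c d d (φ^[h] i) k * (bsb c d ^ (-s) * δ) := by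
        rw [← mul_right_inj (bsb c d ^ ((h : ℤ) * d)), ← mul_assoc, ← zpow_add,
          add_sub_cancel, hx, ← mul_assoc, hmain]
        group
      refine mem_bsΛ_of_prod_mul_mem hc0 hd0
        (List.ofFn fun μ : Fin (k + 1) => ((φ^[h] i) μ : ℤ)) ?_
        (mul_mem (bsb_zpow_mem_bsPos c d _) (bsΛ_le_bsPos c d hδ)) ?_
      · intro n hn
        obtain ⟨j, rfl⟩ := List.mem_ofFn.mp hn
        exact ((φ^[h] i) j).2.2
      · rw [← alphaSeq_eq_list_prod, ← hfac]
        obtain ⟨y, hy, hiy⟩ := exists_alphaSeq_eq c d d i k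
        have hyδ := bsΛ_le_bsPos c d (mul_mem hy hδ)
        rw [hiy, mul_assoc, mul_assoc] at hx
        obtain ⟨n, hn, rfl | ⟨z, hz, rfl⟩⟩ := exists_zpow_of_mem_bsΛ hγ
        · rw [← zpow_add] at hx
          exact absurd hx (zpow_ne_zpow_mul_bsa_mul hc0.ne' hd0.ne' _ _ hyδ)
        · rw [← mul_assoc, ← zpow_add] at hx
          obtain ⟨q, hq⟩ := dvd_sub_of_zpow_mul_bsa_mul_eq hc0.ne' hd0.ne'
            (bsΛ_le_bsPos c d hz) hyδ hx
          have hqh : (h : ℤ) ≤ -q := by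
            by_contra! hlt
            have : -q ≤ (h : ℤ) - 1 := by omega
            nlinarith
          have hi := (i 0).2.1
          rw [← mul_assoc, ← zpow_add]
          exact mul_mem (bsb_zpow_mem_bsΛ c d (by nlinarith)) (mul_mem (bsa_mem_bsΛ c d) hz)
    · rw [hx, hmain]
      group
  · rintro ⟨γ, hγ, rfl⟩
    refine ⟨?_, _, mul_mem (bsb_zpow_mem_bsΛ c d hsum) hγ, by rw [hmain, mul_assoc]⟩
    obtain ⟨y, hy, hiy⟩ := exists_alphaSeq_eq c d d (φ^[h] i) k
    refine ⟨bsb c d ^ ((h : ℤ) * d + i 0 - m) * (bsa c d * y * γ),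
      mul_mem (bsb_zpow_mem_bsΛ c d (by linarith))
        (mul_mem (mul_mem (bsa_mem_bsΛ c d) hy) hγ), ?_⟩
    rw [hiy, h0]
    group
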